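/- arXiv:0801.3615 — 3 statements merged into one kernel-verified Lean document; each statement's English description precedes it below -/
import Mathlib

section
/- Let m ≥ 1, h > 0, γ > 0, and let V : ℝᵐ → ℝ and u : ℝ^{3m} → ℝ be smooth. On ℝ^{3m} with coordinates (x,y,z), set φ(x,y,z) = V(x) + |y|²/2 + |z|²/2 − z·x, and let A be the 3m×3m matrix with m×m blocks A = (1/2)·[[0, I, 0], [−I, 0, 0], [0, 0, γI]], with symmetric part B = (1/2)·[[0,0,0],[0,0,0],[0,0,γI]] and antisymmetric part C = (1/2)·[[0,I,0],[−I,0,0],[0,0,0]]. Then the Witten–Hodge expression Σ_{j,k} hD_j( B_{jk} hD_k u ) + (Σ_{j,k} (∂_jφ) B_{jk} (∂_kφ)) u − h·tr( B·Hess φ ) u + Σ_{j,k} [ (∂_kφ) C_{jk} h∂_j u + h∂_j( C_{jk} (∂_kφ) u ) ] (indices running over all 3m coordinates, D_j = −i∂_j) equals (γ/2) Σ_j ( −h∂_{z_j} + (z_j − x_j) )[ ( h∂_{z_j} + (z_j − x_j) ) u ] + Σ_j y_j h∂_{x_j} u − Σ_j ( ∂_{x_j}V − z_j ) h∂_{y_j}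 u. -/
open scoped BigOperators

/-- Partial derivative `∂_j f` of a real-valued function on `ℝ^ι`. -/
noncomputable def pd {ι : Type*} [Fintype ι] [DecidableEq ι]
    (j : ι) (f : (ι → ℝ) → ℝ) (v : ι → ℝ) : ℝ :=
  fderiv ℝ f v (Pi.single j 1)

/-- Partial derivative `∂_j f` of a complex-valued function on `ℝ^ι`. -/
noncomputable def pdC {ι : Type*} [Fintype ι] [DecidableEq ι]
    (j : ι) (f : (ι → ℝ) → ℂ) (v : ι → ℝ) : ℂ :=
  fderiv ℝ f v (Pi.single j 1)

section PartialDerivatives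

variable {ι : Type*} [Fintype ι] [DecidableEq ι] {f g : (ι → ℝ) → ℝ} {p : ι → ℝ}

theorem pd_fun_add (j : ι) (hf : DifferentiableAt ℝ f p) (hg : DifferentiableAt ℝ g p) :
    pd j (fun v => f v + g v) p = pd j f p + pd j g p := by
  simp [pd, fderiv_fun_add hf hg]

theorem pd_fun_sub (j : ι) (hf : DifferentiableAt ℝ f p) (hg : DifferentiableAt ℝ g p) :
    pd j (fun v => f v - g v) p = pd j f p - pd j g p := by
  simp [pd, fderiv_fun_sub hf hg]

theorem pd_fun_mul (j : ι) (hf : DifferentiableAt ℝ f p) (hg : DifferentiableAt ℝ g p) :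
    pd j (fun v => f v * g v) p = pd j f p * g p + f p * pd j g p := by
  simp [pd, fderiv_fun_mul hf hg]
  ring

theorem pd_const_mul (j : ι) (c : ℝ) (hf : DifferentiableAt ℝ f p) :
    pd j (fun v => c * f v) p = c * pd j f p := by
  simp [pd, fderiv_const_mul hf]

theorem pd_fun_div_const (j : ι) (c : ℝ) (hf : DifferentiableAt ℝ f p) :
    pd j (fun v => f v / c) p = pd j f p / c := by
  simp only [div_eq_inv_mul, pd_const_mul j _ hf]

theorem pd_fun_sum {κ : Type*} (s : Finset κ) {F : κ → (ι → ℝ) → ℝ} (j : ι)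
    (hF : ∀ i ∈ s, DifferentiableAt ℝ (F i) p) :
    pd j (fun v => ∑ i ∈ s, F i v) p = ∑ i ∈ s, pd j (F i) p := by
  simp [pd, fderiv_fun_sum hF]

theorem pd_apply (j k : ι) (p : ι → ℝ) :
    pd j (fun v => v k) p = if k = j then 1 else 0 := by
  simp [pd, (hasFDerivAt_apply (𝕜 := ℝ) k p).fderiv, Pi.single_apply]

theorem pd_apply_sq (j k : ι) (p : ι → ℝ) :
    pd j (fun v => v k ^ 2) p = if k = j then 2 * p k else 0 := by
  simp only [pow_two, pd_fun_mul j (differentiableAt_apply k p) (differentiableAt_apply k p),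
    pd_apply]
  split_ifs <;> ring

theorem contDiff_pd (j : ι) (hf : ContDiff ℝ (⊤ : ℕ∞) f) :
    ContDiff ℝ (⊤ : ℕ∞) (pd j f) :=
  (hf.fderiv_right (m := (⊤ : ℕ∞)) (by simp)).clm_apply contDiff_const

theorem pdC_ofReal (j : ι) (hf : DifferentiableAt ℝ f p) :
    pdC j (fun v => (f v : ℂ)) p = (pd j f p : ℂ) := by
  have := (Complex.ofRealCLM.hasFDerivAt.comp p hf.hasFDerivAt).fderiv
  simp only [pdC, pd]
  change fderiv ℝ (Complex.ofRealCLM ∘ f) p _ = _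
  rw [this]
  simp

theorem pdC_const_mul (j : ι) (c : ℂ) {f : (ι → ℝ) → ℂ} (hf : DifferentiableAt ℝ f p) :
    pdC j (fun v => c * f v) p = c * pdC j f p := by
  simp [pdC, fderiv_const_mul hf]

end PartialDerivatives

section Pullback

variable {α β : Type*} [Fintype α] [Fintype β] {G : (α → ℝ) → ℝ} {p : α ⊕ β → ℝ}

theorem fderiv_comp_inl (hG : DifferentiableAt ℝ G fun a => p (Sum.inl a)) (w : α ⊕ β → ℝ) :
    fderiv ℝ (fun v : α ⊕ β → ℝ => G fun a => v (Sum.inl a)) p w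
      = fderiv ℝ G (fun a => p (Sum.inl a)) fun a => w (Sum.inl a) := by
  have hL := (ContinuousLinearMap.pi fun a : α =>
    ContinuousLinearMap.proj (R := ℝ) (φ := fun _ : α ⊕ β => ℝ) (Sum.inl a)).hasFDerivAt (x := p)
  have := (HasFDerivAt.comp p (g := G) hG.hasFDerivAt hL).fderiv
  exact congrArg (fun T => T w) this

variable [DecidableEq α] [DecidableEq β]

theorem pd_inl_comp_inl (i : α) (hG : DifferentiableAt ℝ G fun a => p (Sum.inl a)) :
    pd (Sum.inl i) (fun v : α ⊕ β → ℝ => G fun a => v (Sum.inl a)) p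
      = pd i G fun a => p (Sum.inl a) := by
  rw [pd, pd, fderiv_comp_inl hG]
  congr 1
  ext a
  simp [Pi.single_apply]

theorem pd_inr_comp_inl (i : β) (hG : DifferentiableAt ℝ G fun a => p (Sum.inl a)) :
    pd (Sum.inr i) (fun v : α ⊕ β → ℝ => G fun a => v (Sum.inl a)) p = 0 := by
  rw [pd, fderiv_comp_inl hG]
  rw [show (fun a : α => (Pi.single (Sum.inr i) 1 : α ⊕ β → ℝ) (Sum.inl a)) = 0 by ext; simp,
    map_zero]

end Pullback

section Potential

variable {m : ℕ} {V : (Fin m → ℝ) → ℝ}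

/-- The potential `V(x) + |y|²/2 + |z|²/2 − z·x` of the chain of oscillators. -/
noncomputable def chainPotential (V : (Fin m → ℝ) → ℝ) (v : Fin m ⊕ (Fin m ⊕ Fin m) → ℝ) : ℝ :=
  V (fun i => v (Sum.inl i))
    + (∑ i, v (Sum.inr (Sum.inl i)) ^ 2) / 2
    + (∑ i, v (Sum.inr (Sum.inr i)) ^ 2) / 2
    - ∑ i, v (Sum.inr (Sum.inr i)) * v (Sum.inl i)

theorem pd_chainPotential (hV : Differentiable ℝ V) (j : Fin m ⊕ (Fin m ⊕ Fin m))
    (p : Fin m ⊕ (Fin m ⊕ Fin m) → ℝ) :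
    pd j (chainPotential V) p = pd j (fun v => V fun i => v (Sum.inl i)) p
      + (∑ i, pd j (fun v => v (Sum.inr (Sum.inl i)) ^ 2) p) / 2
      + (∑ i, pd j (fun v => v (Sum.inr (Sum.inr i)) ^ 2) p) / 2
      - ∑ i, pd j (fun v => v (Sum.inr (Sum.inr i)) * v (Sum.inl i)) p := by
  unfold chainPotential
  rw [pd_fun_sub _ (by fun_prop) (by fun_prop), pd_fun_add _ (by fun_prop) (by fun_prop),
    pd_fun_add _ (by fun_prop) (by fun_prop), pd_fun_div_const _ _ (by fun_prop),
    pd_fun_div_const _ _ (by fun_prop), pd_fun_sum _ _ (fun _ _ => by fun_prop),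
    pd_fun_sum _ _ (fun _ _ => by fun_prop), pd_fun_sum _ _ (fun _ _ => by fun_prop)]

theorem pd_mul_coord (j k l : Fin m ⊕ (Fin m ⊕ Fin m)) (p : Fin m ⊕ (Fin m ⊕ Fin m) → ℝ) :
    pd j (fun v => v k * v l) p
      = (if k = j then 1 else 0) * p l + p k * if l = j then 1 else 0 := by
  rw [pd_fun_mul j (differentiableAt_apply k p) (differentiableAt_apply l p), pd_apply, pd_apply]

theorem pd_x_chainPotential (hV : Differentiable ℝ V) (i : Fin m) :
    pd (Sum.inl i) (chainPotential V)
      = fun p => pd i V (fun a => p (Sum.inl a)) - p (Sum.inr (Sum.inr i)) := by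
  ext p
  simp [pd_chainPotential hV, pd_inl_comp_inl i (hV _), pd_apply_sq, pd_mul_coord]

theorem pd_y_chainPotential (hV : Differentiable ℝ V) (i : Fin m) :
    pd (Sum.inr (Sum.inl i)) (chainPotential V) = fun p => p (Sum.inr (Sum.inl i)) := by
  ext p
  simp [pd_chainPotential hV, pd_inr_comp_inl _ (hV _), pd_apply_sq, pd_mul_coord]

theorem pd_z_chainPotential (hV : Differentiable ℝ V) (i : Fin m) :
    pd (Sum.inr (Sum.inr i)) (chainPotential V)
      = fun p => p (Sum.inr (Sum.inr i)) - p (Sum.inl i) := by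
  ext p
  simp [pd_chainPotential hV, pd_inr_comp_inl _ (hV _), pd_apply_sq, pd_mul_coord]

end Potential

/- STATEMENT 8: on ℝ^{3m} with coordinates (x,y,z) (indexed by Fin m ⊕ (Fin m ⊕ Fin m)),
φ = V(x) + |y|²/2 + |z|²/2 − z·x and A = (1/2)[[0,I,0],[−I,0,0],[0,0,γI]] = B + C,
the Witten–Hodge expression
Σ hD_j(B_{jk} hD_k u) + (Σ ∂_jφ B_{jk} ∂_kφ)u − h tr(B Hess φ)u
+ Σ [(∂_kφ)C_{jk} h∂_j u + h∂_j(C_{jk}(∂_kφ)u)]   (D_j = −i∂_j)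
equals the chain-of-oscillators generator
(γ/2)Σ(−h∂_{z_j}+(z_j−x_j))[(h∂_{z_j}+(z_j−x_j))u] + Σ y_j h∂_{x_j}u
− Σ(∂_{x_j}V − z_j) h∂_{y_j}u. -/
theorem stmt8 (m : ℕ) (hm : 1 ≤ m) (h γ : ℝ) (hh : 0 < h) (hγ : 0 < γ)
    (V : (Fin m → ℝ) → ℝ) (hV : ContDiff ℝ (⊤ : ℕ∞) V)
    (u : ((Fin m ⊕ (Fin m ⊕ Fin m)) → ℝ) → ℝ) (hu : ContDiff ℝ (⊤ : ℕ∞) u)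
    (φ : ((Fin m ⊕ (Fin m ⊕ Fin m)) → ℝ) → ℝ)
    (hφ : φ = fun v => V (fun i => v (Sum.inl i))
        + (∑ i, v (Sum.inr (Sum.inl i)) ^ 2) / 2
        + (∑ i, v (Sum.inr (Sum.inr i)) ^ 2) / 2
        - ∑ i, v (Sum.inr (Sum.inr i)) * v (Sum.inl i))
    (A B C : Matrix (Fin m ⊕ (Fin m ⊕ Fin m)) (Fin m ⊕ (Fin m ⊕ Fin m)) ℝ)
    (hA : A = B + C)
    (hB : B = Matrix.of fun j k =>
      match j, k with
      | Sum.inr (Sum.inr a), Sum.inr (Sum.inr b) => if a = b then γ / 2 else 0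
      | _, _ => 0)
    (hC : C = Matrix.of fun j k =>
      match j, k with
      | Sum.inl a, Sum.inr (Sum.inl b) => if a = b then (1 : ℝ) / 2 else 0
      | Sum.inr (Sum.inl a), Sum.inl b => if a = b then -(1 : ℝ) / 2 else 0
      | _, _ => 0) :
    ∀ p : (Fin m ⊕ (Fin m ⊕ Fin m)) → ℝ,
      ((∑ j, ∑ k, (-Complex.I * (h : ℂ)) *
            pdC j (fun v => (B j k : ℂ) *
              ((-Complex.I * (h : ℂ)) * pdC k (fun w => ((u w : ℝ) : ℂ)) v)) p)
        + (((∑ j, ∑ k, pd j φ p * B j k * pd k φ p : ℝ)) : ℂ) * ((u p : ℝ) : ℂ)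
        - (h : ℂ) * (((∑ j, ∑ k, B j k * pd k (fun w => pd j φ w) p : ℝ)) : ℂ)
            * ((u p : ℝ) : ℂ)
        + (((∑ j, ∑ k, (pd k φ p * C j k * (h * pd j u p)
              + h * pd j (fun w => C j k * pd k φ w * u w) p) : ℝ)) : ℂ))
      = ((γ / 2 * ∑ i,
            (-(h * pd (Sum.inr (Sum.inr i))
                  (fun w => h * pd (Sum.inr (Sum.inr i)) u w
                    + (w (Sum.inr (Sum.inr i)) - w (Sum.inl i)) * u w) p)
              + (p (Sum.inr (Sum.inr i)) - p (Sum.inl i)) *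
                  (h * pd (Sum.inr (Sum.inr i)) u p
                    + (p (Sum.inr (Sum.inr i)) - p (Sum.inl i)) * u p))
          + (∑ i, p (Sum.inr (Sum.inl i)) * (h * pd (Sum.inl i) u p))
          - (∑ i, (pd i V (fun a => p (Sum.inl a)) - p (Sum.inr (Sum.inr i)))
              * (h * pd (Sum.inr (Sum.inl i)) u p))
          : ℝ) : ℂ) := by
  intro p
  have hV1 : Differentiable ℝ V := hV.differentiable (by simp)
  have hu1 : Differentiable ℝ u := hu.differentiable (by simp)
  have hu2 : ∀ k, Differentiable ℝ (pd k u) := fun k =>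
    (contDiff_pd k hu).differentiable (by simp)
  have hV2 : ∀ k, Differentiable ℝ (pd k V) := fun k =>
    (contDiff_pd k hV).differentiable (by simp)
  replace hφ : φ = chainPotential V := hφ
  have second_order : ∀ j k, (-Complex.I * (h : ℂ)) *
      pdC j (fun v => (B j k : ℂ) *
        ((-Complex.I * (h : ℂ)) * pdC k (fun w => ((u w : ℝ) : ℂ)) v)) p
      = ((-(h ^ 2 * (B j k * pd j (pd k u) p)) : ℝ) : ℂ) := by
    intro j k
    have hd : DifferentiableAt ℝ (fun v => (pd k u v : ℂ)) p :=
      Complex.ofRealCLM.differentiableAt.comp p (hu2 k p)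
    simp only [pdC_ofReal k (hu1 _)]
    rw [pdC_const_mul _ _ (hd.const_mul _), pdC_const_mul _ _ hd, pdC_ofReal _ (hu2 k p)]
    push_cast
    linear_combination (h : ℂ) ^ 2 * B j k * pd j (pd k u) p * Complex.I_sq
  simp only [second_order]
  norm_cast
  have hx := pd_x_chainPotential hV1
  have hy := pd_y_chainPotential hV1
  have hz := pd_z_chainPotential hV1
  have hzz : ∀ i : Fin m, pd (Sum.inr (Sum.inr i))
      (fun w => w (Sum.inr (Sum.inr i)) - w (Sum.inl i)) p = 1 := fun i => by
    rw [pd_fun_sub _ (by fun_prop) (by fun_prop), pd_apply, pd_apply]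
    simp
  have hBz : ∀ i : Fin m, pd (Sum.inr (Sum.inr i))
      (fun w => h * pd (Sum.inr (Sum.inr i)) u w
        + (w (Sum.inr (Sum.inr i)) - w (Sum.inl i)) * u w) p
      = h * pd (Sum.inr (Sum.inr i)) (pd (Sum.inr (Sum.inr i)) u) p + (u p
        + (p (Sum.inr (Sum.inr i)) - p (Sum.inl i)) * pd (Sum.inr (Sum.inr i)) u p) := fun i => by
    have := hu2 (Sum.inr (Sum.inr i))
    rw [pd_fun_add _ (by fun_prop) (by fun_prop), pd_const_mul _ _ (by fun_prop),
      pd_fun_mul _ (by fun_prop) (by fun_prop), hzz, one_mul]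
  have hCxy : ∀ i : Fin m, pd (Sum.inl i)
      (fun w => (1 : ℝ) / 2 * w (Sum.inr (Sum.inl i)) * u w) p
      = 1 / 2 * p (Sum.inr (Sum.inl i)) * pd (Sum.inl i) u p := fun i => by
    rw [pd_fun_mul _ (by fun_prop) (by fun_prop), pd_const_mul _ _ (by fun_prop), pd_apply]
    simp
  have hCyx : ∀ i : Fin m, pd (Sum.inr (Sum.inl i))
      (fun w => -(1 : ℝ) / 2 * (pd i V (fun a => w (Sum.inl a)) - w (Sum.inr (Sum.inr i))) * u w) p
      = -1 / 2 * (pd i V (fun a => p (Sum.inl a)) - p (Sum.inr (Sum.inr i)))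
        * pd (Sum.inr (Sum.inl i)) u p := fun i => by
    have := hV2 i
    rw [pd_fun_mul _ (by fun_prop) (by fun_prop), pd_const_mul _ _ (by fun_prop),
      pd_fun_sub _ (by fun_prop) (by fun_prop), pd_inr_comp_inl _ (hV2 i _), pd_apply]
    simp
  have hzero : ∀ j, pd j (fun _ => (0 : ℝ)) p = 0 := fun j => by simp [pd]
  have sumC : ∑ j, ∑ k, (pd k φ p * C j k * (h * pd j u p)
        + h * pd j (fun w => C j k * pd k φ w * u w) p)
      = (∑ i, p (Sum.inr (Sum.inl i)) * (h * pd (Sum.inl i) u p))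
        - ∑ i, (pd i V (fun a => p (Sum.inl a)) - p (Sum.inr (Sum.inr i)))
            * (h * pd (Sum.inr (Sum.inl i)) u p) := by
    have hterm : ∀ j k, C j k = 0 → pd k φ p * C j k * (h * pd j u p)
        + h * pd j (fun w => C j k * pd k φ w * u w) p = 0 := fun j k hjk => by
      simp [hjk, hzero]
    have hxy : ∀ a, ∑ k, (pd k φ p * C (Sum.inl a) k * (h * pd (Sum.inl a) u p)
        + h * pd (Sum.inl a) (fun w => C (Sum.inl a) k * pd k φ w * u w) p)
        = p (Sum.inr (Sum.inl a)) * (h * pd (Sum.inl a) u p) := fun a => by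
      rw [Fintype.sum_eq_single (Sum.inr (Sum.inl a))]
      · have : C (Sum.inl a) (Sum.inr (Sum.inl a)) = 1 / 2 := by simp [hC]
        simp only [this, hφ, hy, hCxy]
        ring
      · rintro (k | k | k) hk <;> apply hterm <;> simp [hC]
        grind
    have hyx : ∀ a, ∑ k, (pd k φ p * C (Sum.inr (Sum.inl a)) k
          * (h * pd (Sum.inr (Sum.inl a)) u p)
        + h * pd (Sum.inr (Sum.inl a))
            (fun w => C (Sum.inr (Sum.inl a)) k * pd k φ w * u w) p)
        = -((pd a V (fun a => p (Sum.inl a)) - p (Sum.inr (Sum.inr a)))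
            * (h * pd (Sum.inr (Sum.inl a)) u p)) := fun a => by
      rw [Fintype.sum_eq_single (Sum.inl a)]
      · have : C (Sum.inr (Sum.inl a)) (Sum.inl a) = -1 / 2 := by simp [hC]
        simp only [this, hφ, hx, hCyx]
        ring
      · rintro (k | k | k) hk <;> apply hterm <;> simp [hC]
        grind
    have hz0 : ∀ a k, C (Sum.inr (Sum.inr a)) k = 0 := fun a k => by
      simp [hC]
    rw [Fintype.sum_sum_type, Fintype.sum_sum_type]
    simp only [hxy, hyx, hterm _ _ (hz0 _ _), Finset.sum_const_zero, Finset.sum_neg_distrib]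
    ring
  have sumB : ∀ F : Fin m ⊕ (Fin m ⊕ Fin m) → Fin m ⊕ (Fin m ⊕ Fin m) → ℝ,
      ∑ j, ∑ k, B j k * F j k
        = γ / 2 * ∑ i, F (Sum.inr (Sum.inr i)) (Sum.inr (Sum.inr i)) := fun F => by
    simp [hB, Fintype.sum_sum_type, Finset.mul_sum]
  have sumB₁ : ∑ j, ∑ k, -(h ^ 2 * (B j k * pd j (pd k u) p))
      = -(h ^ 2 * (γ / 2 * ∑ i, pd (Sum.inr (Sum.inr i)) (pd (Sum.inr (Sum.inr i)) u) p)) := by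
    rw [← sumB fun j k => pd j (pd k u) p]
    simp only [Finset.sum_neg_distrib, Finset.mul_sum]
  have sumB₂ : ∑ j, ∑ k, pd j φ p * B j k * pd k φ p
      = γ / 2 * ∑ i, (p (Sum.inr (Sum.inr i)) - p (Sum.inl i)) ^ 2 := by
    simp only [mul_comm _ (B _ _), mul_assoc]
    rw [sumB fun j k => pd j φ p * pd k φ p]
    simp only [hφ, hz, pow_two]
  have sumB₃ : ∑ j, ∑ k, B j k * pd k (fun w => pd j φ w) p = γ / 2 * ∑ _i : Fin m, 1 := by
    rw [sumB fun j k => pd k (fun w => pd j φ w) p]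
    simp only [hφ, hz, hzz]
  rw [sumB₁, sumB₂, sumB₃, sumC]
  simp only [hBz]
  have key : -(h ^ 2 * (γ / 2 * ∑ i, pd (Sum.inr (Sum.inr i)) (pd (Sum.inr (Sum.inr i)) u) p))
      + γ / 2 * (∑ i, (p (Sum.inr (Sum.inr i)) - p (Sum.inl i)) ^ 2) * u p
      - h * (γ / 2 * ∑ _i : Fin m, 1) * u p
      = γ / 2 * ∑ i, (-(h * (h * pd (Sum.inr (Sum.inr i)) (pd (Sum.inr (Sum.inr i)) u) p + (u p
          + (p (Sum.inr (Sum.inr i)) - p (Sum.inl i)) * pd (Sum.inr (Sum.inr i)) u p)))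
        + (p (Sum.inr (Sum.inr i)) - p (Sum.inl i)) * (h * pd (Sum.inr (Sum.inr i)) u p
          + (p (Sum.inr (Sum.inr i)) - p (Sum.inl i)) * u p)) := by
    simp only [Finset.mul_sum, Finset.sum_mul, ← Finset.sum_neg_distrib,
      ← Finset.sum_add_distrib, ← Finset.sum_sub_distrib]
    exact Finset.sum_congr rfl fun i _ => by ring
  linear_combination key
end

section
/- Let d ≥ 1, C_V ≥ 1, and let V : ℝ^d → ℝ be C² with ‖Hess V(x)‖ ≤ C_V for all x ∈ ℝ^d. Fix z₀ ∈ ℝ^d and let (x(t), y(t)) be a solution on [0, 1/C_V] of the system ẋ = y, ẏ = −(∇V(x) − z₀) with x(0) = x₀, y(0) = y₀. If |y₀| ≤ |∇V(x₀) − z₀|, then for every t ∈ [0, 1/C_V] one has sup_{s ∈ [0,t]} | y(s) − y₀ + s (∇V(x₀) − z₀) | ≤ 2 C_V t² |∇V(x₀) − z₀|. -/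
theorem ContDiff.differentiable_gradient {F : Type*} [NormedAddCommGroup F]
    [InnerProductSpace ℝ F] [CompleteSpace F] {f : F → ℝ} (hf : ContDiff ℝ 2 f) :
    Differentiable ℝ (gradient f) := by
  have hd : Differentiable ℝ (fderiv ℝ f) :=
    (hf.fderiv_right (m := 1) (by norm_num)).differentiable (by norm_num)
  exact (InnerProductSpace.toDual ℝ F).symm.toContinuousLinearEquiv.differentiable.comp hd

/- STATEMENT 15: for the characteristic flow ẋ = y, ẏ = −(∇V(x) − z₀) with
‖Hess V‖ ≤ C_V everywhere and |y₀| ≤ |∇V(x₀) − z₀|, one has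
sup_{s∈[0,t]} |y(s) − y₀ + s(∇V(x₀) − z₀)| ≤ 2 C_V t² |∇V(x₀) − z₀|
for all t ∈ [0, 1/C_V]. -/
theorem stmt15 (d : ℕ) (hd : 1 ≤ d) (CV : ℝ) (hCV : 1 ≤ CV)
    (V : EuclideanSpace ℝ (Fin d) → ℝ) (hV : ContDiff ℝ 2 V)
    (hHess : ∀ x, ‖fderiv ℝ (gradient V) x‖ ≤ CV)
    (z₀ x₀ y₀ : EuclideanSpace ℝ (Fin d))
    (x y : ℝ → EuclideanSpace ℝ (Fin d))
    (hx0 : x 0 = x₀) (hy0 : y 0 = y₀)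
    (hx : ∀ t ∈ Set.Icc (0 : ℝ) (1 / CV), HasDerivAt x (y t) t)
    (hy : ∀ t ∈ Set.Icc (0 : ℝ) (1 / CV),
      HasDerivAt y (-(gradient V (x t) - z₀)) t)
    (hinit : ‖y₀‖ ≤ ‖gradient V x₀ - z₀‖) :
    ∀ t ∈ Set.Icc (0 : ℝ) (1 / CV), ∀ s ∈ Set.Icc (0 : ℝ) t,
      ‖y s - y₀ + s • (gradient V x₀ - z₀)‖
        ≤ 2 * CV * t ^ 2 * ‖gradient V x₀ - z₀‖ := by
  intro t ht
  have hC : 0 < CV := by linarith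
  have ht0 : 0 ≤ t := ht.1
  have htC : CV * t ≤ 1 := by
    have := (le_div_iff₀ hC).1 ht.2
    linarith
  have ht1 : t ≤ 1 := by nlinarith
  have hsub : ∀ s ∈ Set.Icc (0 : ℝ) t, s ∈ Set.Icc (0 : ℝ) (1 / CV) :=
    fun s hs => ⟨hs.1, hs.2.trans ht.2⟩
  have hLip : ∀ a b, ‖gradient V a - gradient V b‖ ≤ CV * ‖a - b‖ := fun a b =>
    convex_univ.norm_image_sub_le_of_norm_fderiv_le
      (fun p _ => hV.differentiable_gradient p) (fun p _ => hHess p)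
      (Set.mem_univ b) (Set.mem_univ a)
  set G := gradient V x₀ - z₀ with hG
  set w : ℝ → EuclideanSpace ℝ (Fin d) := fun s => y s - y₀ + s • G with hw
  have hwd : ∀ s ∈ Set.Icc (0 : ℝ) t,
      HasDerivAt w (-(gradient V (x s) - gradient V x₀)) s := by
    intro s hs
    have h := ((hy s (hsub s hs)).sub_const y₀).add ((hasDerivAt_id s).smul_const G)
    have he : -(gradient V (x s) - z₀) + (1 : ℝ) • G =
        -(gradient V (x s) - gradient V x₀) := by
      rw [hG, one_smul]
      abel
    exact h.congr_deriv he
  have hwc : ContinuousOn w (Set.Icc 0 t) :=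
    fun s hs => (hwd s hs).continuousAt.continuousWithinAt
  obtain ⟨m, hm, hmax⟩ :=
    isCompact_Icc.exists_isMaxOn (Set.nonempty_Icc.2 ht0) hwc.norm
  have hM : ∀ s ∈ Set.Icc (0 : ℝ) t, ‖w s‖ ≤ ‖w m‖ := fun s hs => hmax hs
  set K := 2 * ‖G‖ + ‖w m‖ with hK
  have hyK : ∀ s ∈ Set.Icc (0 : ℝ) t, ‖y s‖ ≤ K := by
    intro s hs
    have he : y s = w s + y₀ - s • G := by simp only [hw]; abel
    have h1 : ‖s • G‖ ≤ ‖G‖ := by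
      rw [norm_smul, Real.norm_of_nonneg hs.1]
      exact mul_le_of_le_one_left (norm_nonneg _) (hs.2.trans ht1)
    have h2 := norm_sub_le (w s + y₀) (s • G)
    have h3 := norm_add_le (w s) y₀
    have h4 := hM s hs
    rw [he]
    linarith
  have hxK : ∀ s ∈ Set.Icc (0 : ℝ) t, ‖x s - x₀‖ ≤ K * s := by
    intro s hs
    have h := norm_image_sub_le_of_norm_deriv_le_segment'
      (fun r hr => (hx r (hsub r hr)).hasDerivWithinAt)
      (fun r hr => hyK r (Set.Ico_subset_Icc_self hr)) s hs
    simpa [hx0] using h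
  have hwB : ∀ s ∈ Set.Icc (0 : ℝ) t, ‖w s‖ ≤ CV * K / 2 * s ^ 2 := by
    intro s hs
    refine image_norm_le_of_norm_deriv_right_le_deriv_boundary
      (B := fun r => CV * K / 2 * r ^ 2) (B' := fun r => CV * (K * r)) hwc
      (fun r hr => (hwd r (Set.Ico_subset_Icc_self hr)).hasDerivWithinAt)
      (by simp [hw, hy0]) (fun r => ?_) (fun r hr => ?_) hs
    · exact ((hasDerivAt_pow 2 r).const_mul (CV * K / 2)).congr_deriv (by norm_num; ring)
    · rw [norm_neg]
      exact (hLip _ _).trans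
        (mul_le_mul_of_nonneg_left (hxK r (Set.Ico_subset_Icc_self hr)) hC.le)
  have hK0 : 0 ≤ K := by positivity
  have hmt : ‖w m‖ ≤ CV * K / 2 * t ^ 2 := by
    refine (hwB m hm).trans ?_
    have := hm.1
    have := hm.2
    gcongr
  have hCt : CV * t ^ 2 ≤ 1 := by nlinarith
  intro s hs
  refine (hM s hs).trans ?_
  have := mul_le_mul_of_nonneg_right hCt (norm_nonneg (w m))
  rw [hK] at hmt
  linarith
end

section
/- Let d ≥ 1, C_V ≥ 1, and let V : ℝ^d → ℝ be C² with ‖Hess V(x)‖ ≤ C_V for all x ∈ ℝ^d. Fix z₀ ∈ ℝ^d and let (x(t), y(t)) be a solution on [0, 1/C_V] of the system ẋ = y, ẏ = −(∇V(x) − z₀) with x(0) = x₀, y(0) = y₀. If |y₀| ≤ |∇V(x₀) − z₀|, then for every t ∈ [0, 1/C_V] one has | x(t) − x₀ − t y₀ + (t²/2)(∇V(x₀) − z₀) | ≤ (2/3) C_V t³ |∇V(x₀) − z₀|. -/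
/-- If `f 0 = 0` and `‖f' s‖ ≤ K s ^ n` on `[0, T]`, then `‖f t‖ ≤ K t ^ (n + 1) / (n + 1)`. -/
theorem norm_le_of_norm_deriv_le_pow {E : Type*} [NormedAddCommGroup E] [NormedSpace ℝ E]
    {f f' : ℝ → E} {T K : ℝ} (n : ℕ) (h0 : f 0 = 0)
    (hf : ∀ s ∈ Set.Icc 0 T, HasDerivAt f (f' s) s)
    (hb : ∀ s ∈ Set.Icc 0 T, ‖f' s‖ ≤ K * s ^ n) :
    ∀ t ∈ Set.Icc 0 T, ‖f t‖ ≤ K * t ^ (n + 1) / (n + 1) := by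
  intro t ht
  refine image_norm_le_of_norm_deriv_right_le_deriv_boundary (f' := f')
    (B := fun s => K * s ^ (n + 1) / (n + 1)) (B' := fun s => K * s ^ n)
    (fun s hs => (hf s hs).continuousAt.continuousWithinAt)
    (fun s hs => (hf s (Set.Ico_subset_Icc_self hs)).hasDerivWithinAt)
    (by simp [h0]) (fun s => ?_) (fun s hs => hb s (Set.Ico_subset_Icc_self hs)) ht
  have h := ((hasDerivAt_pow (n + 1) s).const_mul K).div_const ((n : ℝ) + 1)
  refine h.congr_deriv ?_
  have : (n : ℝ) + 1 ≠ 0 := by positivity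
  push_cast
  field_simp

/-- A `C²` function whose gradient has derivative bounded by `C` has `C`-Lipschitz gradient. -/
theorem norm_gradient_sub_le {E : Type*} [NormedAddCommGroup E] [InnerProductSpace ℝ E]
    [CompleteSpace E] {V : E → ℝ} {C : ℝ} (hV : ContDiff ℝ 2 V)
    (hHess : ∀ x, ‖fderiv ℝ (gradient V) x‖ ≤ C) (a b : E) :
    ‖gradient V a - gradient V b‖ ≤ C * ‖a - b‖ := by
  have hd : Differentiable ℝ (gradient V) := by
    have h : Differentiable ℝ (fderiv ℝ V) :=
      (hV.fderiv_right (m := 1) (by norm_num)).differentiable (by norm_num)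
    exact (InnerProductSpace.toDual ℝ E).symm.toContinuousLinearEquiv.differentiable.comp h
  exact convex_univ.norm_image_sub_le_of_norm_fderiv_le (fun x _ => hd x) (fun x _ => hHess x)
    (Set.mem_univ b) (Set.mem_univ a)

/-- Third-order Taylor estimate for the position of a Newtonian trajectory `x'' = -F x` whose
force field is `C`-Lipschitz, on a time interval `[0, T]` with `T ≤ 1` and `C T² ≤ 1`. -/
theorem norm_position_sub_taylor_le {E : Type*} [NormedAddCommGroup E] [NormedSpace ℝ E]
    {F : E → E} {C T : ℝ} (hC : 0 ≤ C) (hT : T ≤ 1) (hCT : C * T ^ 2 ≤ 1)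
    (hF : ∀ a b, ‖F a - F b‖ ≤ C * ‖a - b‖) {x y : ℝ → E}
    (hx : ∀ t ∈ Set.Icc 0 T, HasDerivAt x (y t) t)
    (hy : ∀ t ∈ Set.Icc 0 T, HasDerivAt y (-F (x t)) t)
    (hinit : ‖y 0‖ ≤ ‖F (x 0)‖) :
    ∀ t ∈ Set.Icc 0 T, ‖x t - x 0 - t • y 0 + (t ^ 2 / 2) • F (x 0)‖
      ≤ 2 / 3 * C * t ^ 3 * ‖F (x 0)‖ := by
  intro t ht
  have hT0 : 0 ≤ T := ht.1.trans ht.2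
  set g := F (x 0) with hg
  have position_bound (M : ℝ) (hM : ∀ s ∈ Set.Icc 0 T, ‖y s‖ ≤ M) :
      ∀ s ∈ Set.Icc 0 T, ‖x s - x 0‖ ≤ M * s := by
    simpa using norm_le_of_norm_deriv_le_pow (K := M) 0 (sub_self (x 0))
      (fun s hs => (hx s hs).sub_const (x 0)) (by simpa using hM)
  have velocity_bound (M : ℝ) (hM : ∀ s ∈ Set.Icc 0 T, ‖y s‖ ≤ M) :
      ∀ s ∈ Set.Icc 0 T, ‖y s - y 0 + s • g‖ ≤ C * M / 2 * s ^ 2 := by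
    intro s hs
    have h := norm_le_of_norm_deriv_le_pow (f := fun s => y s - y 0 + s • g)
      (f' := fun s => -F (x s) + (1 : ℝ) • g) (K := C * M) (T := T) 1 (by simp)
      (fun s hs => ((hy s hs).sub_const (y 0)).add ((hasDerivAt_id s).smul_const g))
      (fun s hs => by
        calc ‖-F (x s) + (1 : ℝ) • g‖ = ‖F (x s) - F (x 0)‖ := by
              rw [← norm_neg (F (x s) - F (x 0)), one_smul, hg]; congr 1; abel
          _ ≤ C * ‖x s - x 0‖ := hF _ _
          _ ≤ C * (M * s) := by gcongr; exact position_bound M hM s hs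
          _ = C * M * s ^ 1 := by ring) s hs
    refine h.trans_eq ?_
    push_cast
    ring
  have speed_bound : ∀ s ∈ Set.Icc 0 T, ‖y s‖ ≤ 4 * ‖g‖ := by
    obtain ⟨r, hr, hmax⟩ := isCompact_Icc.exists_isMaxOn (Set.nonempty_Icc.2 hT0)
      (f := fun s => ‖y s‖) (fun s hs => (hy s hs).continuousAt.norm.continuousWithinAt)
    have hv := velocity_bound ‖y r‖ (fun s hs => hmax hs) r hr
    have hsq : C * r ^ 2 ≤ 1 := by
      refine le_trans ?_ hCT
      have := hr.1
      gcongr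
      exact hr.2
    have htri : ‖y r‖ ≤ ‖y r - y 0 + r • g‖ + ‖y 0‖ + ‖r • g‖ := by
      calc ‖y r‖ = ‖(y r - y 0 + r • g) + y 0 - r • g‖ := by congr 1; abel
        _ ≤ _ := (norm_sub_le _ _).trans (by gcongr; exact norm_add_le _ _)
    have hrg : ‖r • g‖ ≤ ‖g‖ := by
      rw [norm_smul, Real.norm_of_nonneg hr.1]
      exact mul_le_of_le_one_left (norm_nonneg _) (hr.2.trans hT)
    have hhalf : C * ‖y r‖ / 2 * r ^ 2 ≤ ‖y r‖ / 2 := by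
      nlinarith [mul_le_mul_of_nonneg_right hsq (norm_nonneg (y r))]
    intro s hs
    have : ‖y s‖ ≤ ‖y r‖ := hmax hs
    linarith
  have h := norm_le_of_norm_deriv_le_pow
    (f := fun s => x s - x 0 - s • y 0 + (s ^ 2 / 2) • g)
    (f' := fun s => y s - y 0 + s • g) (K := 2 * C * ‖g‖) (T := T) 2 (by simp)
    (fun s hs => by
      have h2 : HasDerivAt (fun s : ℝ => s ^ 2 / 2) s s := by
        simpa using (hasDerivAt_pow 2 s).div_const 2
      exact ((((hx s hs).sub_const (x 0)).sub
        ((hasDerivAt_id s).smul_const (y 0))).add (h2.smul_const g)).congr_deriv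
          (by rw [one_smul]))
    (fun s hs => (velocity_bound _ speed_bound s hs).trans_eq (by ring)) t ht
  refine h.trans_eq ?_
  push_cast
  ring

/- STATEMENT 16: for the characteristic flow ẋ = y, ẏ = −(∇V(x) − z₀) with
‖Hess V‖ ≤ C_V everywhere and |y₀| ≤ |∇V(x₀) − z₀|, one has
|x(t) − x₀ − t y₀ + (t²/2)(∇V(x₀) − z₀)| ≤ (2/3) C_V t³ |∇V(x₀) − z₀|
for all t ∈ [0, 1/C_V]. -/
theorem stmt16 (d : ℕ) (hd : 1 ≤ d) (CV : ℝ) (hCV : 1 ≤ CV)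
    (V : EuclideanSpace ℝ (Fin d) → ℝ) (hV : ContDiff ℝ 2 V)
    (hHess : ∀ x, ‖fderiv ℝ (gradient V) x‖ ≤ CV)
    (z₀ x₀ y₀ : EuclideanSpace ℝ (Fin d))
    (x y : ℝ → EuclideanSpace ℝ (Fin d))
    (hx0 : x 0 = x₀) (hy0 : y 0 = y₀)
    (hx : ∀ t ∈ Set.Icc (0 : ℝ) (1 / CV), HasDerivAt x (y t) t)
    (hy : ∀ t ∈ Set.Icc (0 : ℝ) (1 / CV),
      HasDerivAt y (-(gradient V (x t) - z₀)) t)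
    (hinit : ‖y₀‖ ≤ ‖gradient V x₀ - z₀‖) :
    ∀ t ∈ Set.Icc (0 : ℝ) (1 / CV),
      ‖x t - x₀ - t • y₀ + (t ^ 2 / 2) • (gradient V x₀ - z₀)‖
        ≤ 2 / 3 * CV * t ^ 3 * ‖gradient V x₀ - z₀‖ := by
  subst hx0 hy0
  have hpos : 0 < CV := by linarith
  have hle : 1 / CV ≤ 1 := (div_le_one hpos).2 hCV
  have hsq : CV * (1 / CV) ^ 2 ≤ 1 := by
    have : CV * (1 / CV) ^ 2 = 1 / CV := by field_simp
    rwa [this]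
  exact norm_position_sub_taylor_le (F := fun a => gradient V a - z₀) hpos.le hle hsq
    (fun a b => by simpa using norm_gradient_sub_le hV hHess a b) hx hy hinit
end
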